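/- Let {Vᵢ}ᵢ₌₁ⁿ be VLSMs over the same message set, each satisfying the channel authentication, message dependencies, sent-oracle and full node assumptions, with a weight function from {1,…,n} to positive reals and a threshold t > 0. Then for every valid trace of the t-limited state-equivocation model V^{<t}_{s_eqv}, its trace reduct, with each composite state annotated by the set of equivocators accumulated as in the definition of V^{<t}_{m_eqv} (starting from ∅), is a valid trace of the t-limited message-equivocation model V^{<t}_{m_eqv}, i.e., a trace under t-limited equivocation behaviour. -/

import Mathlib

set_option autoImplicit false

universe u v w

/-- A validating labelled state transition and message production system (VLSM):
labels, a nonempty set of initial states, initial messages, a total transition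
function and a validity constraint.  `Option M` plays the role of `M ∪ {⊥}`. -/
structure VLSM (L : Type u) (S : Type v) (M : Type w) where
  init : Set S
  init_ne : init.Nonempty
  initMsg : Set M
  tau : L → S → Option M → S × Option M
  beta : L → S → Option M → Prop

/-- A transition record: label, source state, input message, target state, output message. -/
structure VTrans (L : Type u) (S : Type v) (M : Type w) where
  lbl : L
  src : S
  msg : Option M
  dst : S
  out : Option M

variable {L : Type u} {S : Type v} {M : Type w}

/-- `Chain s tr sf`: the transitions of `tr` link up, starting at `s` and ending at `sf`. -/
def Chain : S → List (VTrans L S M) → S → Prop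
  | s, [], sf => s = sf
  | s, t :: ts, sf => t.src = s ∧ Chain t.dst ts sf

namespace VLSM

/-- `t` is an actual transition of `V` (the transition function agrees with `t`). -/
def IsTrans (V : VLSM L S M) (t : VTrans L S M) : Prop :=
  V.tau t.lbl t.src t.msg = (t.dst, t.out)

/-- `t` is a constrained transition of `V`. -/
def IsConstrainedTrans (V : VLSM L S M) (t : VTrans L S M) : Prop :=
  V.IsTrans t ∧ V.beta t.lbl t.src t.msg

/-- `tr` is a constrained trace of `V` reaching the state `sf`. -/
def ConstrainedTraceTo (V : VLSM L S M) (tr : List (VTrans L S M)) (sf : S) : Prop :=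
  (∀ t ∈ tr, V.IsConstrainedTrans t) ∧ ∃ s0 ∈ V.init, Chain s0 tr sf

/-- A state is constrained if some constrained trace reaches it. -/
def ConstrainedState (V : VLSM L S M) (s : S) : Prop :=
  ∃ tr, V.ConstrainedTraceTo tr s

/-- Constrained reachability, defined inductively (a state is constrained iff it is
reachable from an initial state by constrained transitions). -/
inductive ReachState (V : VLSM L S M) : S → Prop where
  | init {s} : s ∈ V.init → ReachState V s
  | step {l s m} : ReachState V s → V.beta l s m → ReachState V (V.tau l s m).1

mutual
  /-- Valid states of a VLSM. -/
  inductive ValidState (V : VLSM L S M) : S → Prop where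
    | init {s} : s ∈ V.init → ValidState V s
    | step {l s m} : ValidState V s → ValidOMsg V m → V.beta l s m →
        ValidState V (V.tau l s m).1
  /-- Valid optional messages of a VLSM (`none` is always valid). -/
  inductive ValidOMsg (V : VLSM L S M) : Option M → Prop where
    | none : ValidOMsg V Option.none
    | init {m} : m ∈ V.initMsg → ValidOMsg V (some m)
    | step {l s m} : ValidState V s → ValidOMsg V m → V.beta l s m →
        ValidOMsg V (V.tau l s m).2
end

/-- `t` is a valid transition of `V`. -/
def IsValidTrans (V : VLSM L S M) (t : VTrans L S M) : Prop :=
  V.IsConstrainedTrans t ∧ V.ValidState t.src ∧ V.ValidOMsg t.msg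

/-- `tr` is a valid trace of `V` reaching the state `sf`. -/
def ValidTraceTo (V : VLSM L S M) (tr : List (VTrans L S M)) (sf : S) : Prop :=
  (∀ t ∈ tr, V.IsValidTrans t) ∧ ∃ s0 ∈ V.init, Chain s0 tr sf

/-- `tr` is a valid trace of `V`. -/
def IsValidTrace (V : VLSM L S M) (tr : List (VTrans L S M)) : Prop :=
  ∃ sf, V.ValidTraceTo tr sf

end VLSM

/-- The message `m` is emitted (sent) on the trace `tr`. -/
def EmittedOn (tr : List (VTrans L S M)) (m : M) : Prop := ∃ t ∈ tr, t.out = some m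

/-- The message `m` is received on the trace `tr`. -/
def ReceivedOn (tr : List (VTrans L S M)) (m : M) : Prop := ∃ t ∈ tr, t.msg = some m

/-- `sent` is a sent-oracle for `V`: at every constrained state `s`, `sent s m` holds
iff `m` is emitted on every constrained trace reaching `s`. -/
def IsSentOracle (V : VLSM L S M) (sent : S → M → Prop) : Prop :=
  ∀ s, V.ConstrainedState s → ∀ m,
    (sent s m ↔ ∀ tr, V.ConstrainedTraceTo tr s → EmittedOn tr m)

/-- `recv` is a received-oracle for `V`. -/
def IsReceivedOracle (V : VLSM L S M) (recv : S → M → Prop) : Prop :=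
  ∀ s, V.ConstrainedState s → ∀ m,
    (recv s m ↔ ∀ tr, V.ConstrainedTraceTo tr s → ReceivedOn tr m)

/-- The full node assumption: whenever receiving `m` is allowed by the validity
constraint, every direct dependency of `m` has been directly observed in the state. -/
def FullNodeAssumption (V : VLSM L S M) (dep : M → M → Prop)
    (sent recv : S → M → Prop) : Prop :=
  ∀ l s m, V.beta l s (some m) → ∀ m', dep m' m → sent s m' ∨ recv s m'

section Composition

variable {ι : Type*} [DecidableEq ι] {Lf : ι → Type*} {Sf : ι → Type*}

/-- The constrained composition of an indexed family of VLSMs over the same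
message set, under the composition constraint `φ`. -/
noncomputable def comp (V : ∀ i, VLSM (Lf i) (Sf i) M)
    (φ : (Σ i, Lf i) → (∀ i, Sf i) → Option M → Prop) :
    VLSM (Σ i, Lf i) (∀ i, Sf i) M where
  init := {σ | ∀ i, σ i ∈ (V i).init}
  init_ne := ⟨fun i => ((V i).init_ne).choose, fun i => ((V i).init_ne).choose_spec⟩
  initMsg := ⋃ i, (V i).initMsg
  tau := fun l σ m =>
    (Function.update σ l.1 ((V l.1).tau l.2 (σ l.1) m).1, ((V l.1).tau l.2 (σ l.1) m).2)
  beta := fun l σ m => (V l.1).beta l.2 (σ l.1) m ∧ φ l σ m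

/-- The free composition of an indexed family of VLSMs over the same message set. -/
noncomputable def freeComp (V : ∀ i, VLSM (Lf i) (Sf i) M) :
    VLSM (Σ i, Lf i) (∀ i, Sf i) M :=
  comp V fun _ _ _ => True

/-- Component `j` is a validator for the composite VLSM `W`: every constrained
transition from a constrained state of `V j` lifts to a valid transition of `W`
with matching `j`-th state components and matching input/output messages. -/
def IsValidatorAt (V : ∀ i, VLSM (Lf i) (Sf i) M)
    (W : VLSM (Σ i, Lf i) (∀ i, Sf i) M) (j : ι) : Prop :=
  ∀ l s m, (V j).ConstrainedState s → (V j).beta l s m →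
    ∃ σ : ∀ i, Sf i, σ j = s ∧
      W.IsValidTrans ⟨⟨j, l⟩, σ, m, (W.tau ⟨j, l⟩ σ m).1, (W.tau ⟨j, l⟩ σ m).2⟩ ∧
      (W.tau ⟨j, l⟩ σ m).1 j = ((V j).tau l s m).1 ∧
      (W.tau ⟨j, l⟩ σ m).2 = ((V j).tau l s m).2

/-- The induced `j`-th projection of a composite VLSM `W`: the same VLSM as the
component `Vj`, except that its initial messages are all valid messages of `W`. -/
def projV {L' : Type*} {S' : Type*} {L2 : Type*} {S2 : Type*}
    (Vj : VLSM L' S' M) (W : VLSM L2 S2 M) : VLSM L' S' M :=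
  { Vj with initMsg := {m | W.ValidOMsg (some m)} }

/-- The projection of a composite trace on component `j`. -/
def projTrace (j : ι) (tr : List (VTrans (Σ i, Lf i) (∀ i, Sf i) M)) :
    List (VTrans (Lf j) (Sf j) M) :=
  tr.filterMap fun t =>
    if h : t.lbl.1 = j then some ⟨h ▸ t.lbl.2, t.src j, t.msg, t.dst j, t.out⟩ else none

/-- The composition constraint of the fixed-set message-equivocation model:
the only message-equivocations allowed are among the components of `E`. -/
def phiM (sender : M → ι) (sent : ∀ i, Sf i → M → Prop) (E : Set ι) :
    (Σ i, Lf i) → (∀ i, Sf i) → Option M → Prop :=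
  fun l σ m => ∀ mm, m = some mm →
    (sent (sender mm) (σ (sender mm)) mm ∨ (l.1 ∈ E ∧ sender mm ∈ E))

end Composition

/-- Labels of the equivocating VLSM associated to a VLSM: act as the `i`-th copy,
duplicate the `i`-th copy, or spawn a new machine after position `i` (1-based). -/
inductive ELabel (L : Type u) (S : Type v) where
  | act (i : ℕ) (l : L)
  | dup (i : ℕ)
  | new (i : ℕ) (s : S)

/-- The equivocating VLSM associated to a VLSM `V`: its states are (nonempty) lists
of states of `V`, and it can fork itself or spawn fresh copies at any moment. -/
noncomputable def eVLSM (V : VLSM L S M) : VLSM (ELabel L S) (List S) M where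
  init := {γ | ∃ s ∈ V.init, γ = [s]}
  init_ne := ⟨[V.init_ne.choose], V.init_ne.choose, V.init_ne.choose_spec, rfl⟩
  initMsg := V.initMsg
  tau := fun lab γ m =>
    match lab with
    | .act i l =>
      match γ[i - 1]? with
      | some s => (γ.set (i - 1) (V.tau l s m).1, (V.tau l s m).2)
      | none => (γ, Option.none)
    | .dup i =>
      match γ[i - 1]? with
      | some s => (γ.take i ++ s :: γ.drop i, Option.none)
      | none => (γ, Option.none)
    | .new i s0 => (γ.take i ++ s0 :: γ.drop i, Option.none)
  beta := fun lab γ m =>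
    match lab with
    | .act i l => 1 ≤ i ∧ i ≤ γ.length ∧ ∃ s, γ[i - 1]? = some s ∧ V.beta l s m
    | .dup i => 1 ≤ i ∧ i ≤ γ.length ∧ m = Option.none
    | .new i s0 => 1 ≤ i ∧ i ≤ γ.length ∧ m = Option.none ∧ s0 ∈ V.init

section LimitedEquivocation

variable {n : ℕ} {Lf Sf : Fin n → Type} {M : Type}

/-- The composition constraint `φ^{<t}_{s_eqv}` of the t-limited state-equivocation
model: messages must have been sent in the current trace, and the total weight of
the components whose list of copies has more than one entry after the transition
stays below the threshold. -/
noncomputable def phiSlim (V : ∀ i, VLSM (Lf i) (Sf i) M) (sender : M → Fin n)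
    (sent : ∀ i, Sf i → M → Prop) (w : Fin n → ℝ) (t : ℝ) :
    (Σ i, ELabel (Lf i) (Sf i)) → (∀ i, List (Sf i)) → Option M → Prop :=
  fun l γ m =>
    (∀ mm, m = some mm → ∃ s ∈ γ (sender mm), sent (sender mm) s mm) ∧
    (∑ k ∈ Finset.univ.filter fun k : Fin n =>
        1 < (Function.update γ l.1 ((eVLSM (V l.1)).tau l.2 (γ l.1) m).1 k).length,
      w k) < t

/-- The t-limited state-equivocation model `V^{<t}_{s_eqv}`: every component is
replaced by its equivocating version. -/
noncomputable def Vslim (V : ∀ i, VLSM (Lf i) (Sf i) M) (sender : M → Fin n)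
    (sent : ∀ i, Sf i → M → Prop) (w : Fin n → ℝ) (t : ℝ) :
    VLSM (Σ i, ELabel (Lf i) (Sf i)) (∀ i, List (Sf i)) M :=
  comp (fun i => eVLSM (V i)) (phiSlim V sender sent w t)

/-- The state reduct for the t-limited state-equivocation model: the first list
entry of each component. -/
noncomputable def reductLim (V : ∀ i, VLSM (Lf i) (Sf i) M)
    (γ : ∀ i, List (Sf i)) : ∀ i, Sf i :=
  fun i => (γ i).headD (V i).init_ne.choose

/-- The transition reduct for the t-limited state-equivocation model. -/
noncomputable def transReductLim (V : ∀ i, VLSM (Lf i) (Sf i) M)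
    (t : VTrans (Σ i, ELabel (Lf i) (Sf i)) (∀ i, List (Sf i)) M) :
    Option (VTrans (Σ i, Lf i) (∀ i, Sf i) M) :=
  match t.lbl.2 with
  | .act 1 l => some ⟨⟨t.lbl.1, l⟩, reductLim V t.src, t.msg, reductLim V t.dst, t.out⟩
  | _ => none

/-- The trace reduct for the t-limited state-equivocation model. -/
noncomputable def traceReductLim (V : ∀ i, VLSM (Lf i) (Sf i) M)
    (tr : List (VTrans (Σ i, ELabel (Lf i) (Sf i)) (∀ i, List (Sf i)) M)) :
    List (VTrans (Σ i, Lf i) (∀ i, Sf i) M) :=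
  tr.filterMap (transReductLim V)

open scoped Classical in
/-- Updating the set of equivocators on a transition: the sender of the received
message is added if the message has not been sent in the current composite state. -/
noncomputable def updEqv (sender : M → Fin n) (sent : ∀ i, Sf i → M → Prop)
    (σ : ∀ i, Sf i) (m : Option M) (eqv : Finset (Fin n)) : Finset (Fin n) :=
  match m with
  | Option.none => eqv
  | some mm => if ∃ i, sent i (σ i) mm then eqv else insert (sender mm) eqv

/-- The t-limited message-equivocation model `V^{<t}_{m_eqv}`: the free composition
annotated with the set of equivocators observed in the current trace, constrained
so that the total weight of equivocators stays below the threshold. -/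
noncomputable def annV (V : ∀ i, VLSM (Lf i) (Sf i) M) (sender : M → Fin n)
    (sent : ∀ i, Sf i → M → Prop) (w : Fin n → ℝ) (t : ℝ) :
    VLSM (Σ i, Lf i) ((∀ i, Sf i) × Finset (Fin n)) M where
  init := {p | (∀ i, p.1 i ∈ (V i).init) ∧ p.2 = ∅}
  init_ne :=
    ⟨⟨fun i => ((V i).init_ne).choose, ∅⟩, fun i => ((V i).init_ne).choose_spec, rfl⟩
  initMsg := ⋃ i, (V i).initMsg
  tau := fun l p m =>
    ((Function.update p.1 l.1 ((V l.1).tau l.2 (p.1 l.1) m).1,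
      updEqv sender sent p.1 m p.2),
     ((V l.1).tau l.2 (p.1 l.1) m).2)
  beta := fun l p m =>
    (V l.1).beta l.2 (p.1 l.1) m ∧
      (∑ j ∈ updEqv sender sent p.1 m p.2, w j) < t

/-- Annotating a trace of the free composition with the accumulated sets of
equivocators, starting from the given set. -/
noncomputable def annotate (sender : M → Fin n) (sent : ∀ i, Sf i → M → Prop) :
    Finset (Fin n) → List (VTrans (Σ i, Lf i) (∀ i, Sf i) M) →
      List (VTrans (Σ i, Lf i) ((∀ i, Sf i) × Finset (Fin n)) M)
  | _, [] => []
  | eqv, t :: ts =>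
      ⟨t.lbl, (t.src, eqv), t.msg, (t.dst, updEqv sender sent t.src t.msg eqv), t.out⟩ ::
        annotate sender sent (updEqv sender sent t.src t.msg eqv) ts

/-- Forgetting the equivocator annotations of a transition. -/
def stripAnn (t : VTrans (Σ i, Lf i) ((∀ i, Sf i) × Finset (Fin n)) M) :
    VTrans (Σ i, Lf i) (∀ i, Sf i) M :=
  ⟨t.lbl, t.src.1, t.msg, t.dst.1, t.out⟩

end LimitedEquivocation

section StateToMessageEquivocation

/-- A constrained transition of the equivocating VLSM either acts on one copy, or is silent:
it then preserves the first copy and adds no copies other than initial or existing states. -/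
theorem eVLSM_step_cases {L S M : Type*} (V : VLSM L S M) (lab : ELabel L S) (γ : List S)
    (m : Option M) (h : (eVLSM V).beta lab γ m) :
    (∃ i l s, lab = .act (i + 1) l ∧ γ[i]? = some s ∧ V.beta l s m ∧
      (eVLSM V).tau lab γ m = (γ.set i (V.tau l s m).1, (V.tau l s m).2)) ∨
    ((∀ i l, lab ≠ .act i l) ∧
      γ.length ≤ ((eVLSM V).tau lab γ m).1.length ∧
      (∀ d, ((eVLSM V).tau lab γ m).1.headD d = γ.headD d) ∧
      ∀ x ∈ ((eVLSM V).tau lab γ m).1,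
        x ∈ γ ∨ (x ∈ V.init ∧ 1 < ((eVLSM V).tau lab γ m).1.length)) := by
  have length_insert : ∀ (i : ℕ) (s : S),
      (γ.take i ++ s :: γ.drop i).length = γ.length + 1 := by
    intro i s
    simp only [List.length_append, List.length_take, List.length_cons, List.length_drop]
    omega
  have mem_insert : ∀ (i : ℕ) (s x : S), x ∈ γ.take i ++ s :: γ.drop i → x = s ∨ x ∈ γ := by
    intro i s x hx
    rcases List.mem_append.1 hx with hx | hx
    · exact Or.inr (List.mem_of_mem_take hx)
    · rcases List.mem_cons.1 hx with hx | hx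
      · exact Or.inl hx
      · exact Or.inr (List.mem_of_mem_drop hx)
  have headD_insert : ∀ (i : ℕ) (s d : S), 1 ≤ i → i ≤ γ.length →
      (γ.take i ++ s :: γ.drop i).headD d = γ.headD d := by
    intro i s d h1 h2
    obtain ⟨k, rfl⟩ : ∃ k, i = k + 1 := ⟨i - 1, by omega⟩
    cases γ with
    | nil => simp at h2
    | cons a γ => simp
  cases lab with
  | act i l =>
    obtain ⟨h1, -, s, hs, hb⟩ := h
    obtain ⟨k, rfl⟩ : ∃ k, i = k + 1 := ⟨i - 1, by omega⟩
    refine Or.inl ⟨k, l, s, rfl, by simpa using hs, hb, ?_⟩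
    have hs' : γ[k]? = some s := by simpa using hs
    simp [eVLSM, hs']
  | dup i =>
    obtain ⟨h1, h2, -⟩ := h
    have hlt : i - 1 < γ.length := by omega
    have htau : ((eVLSM V).tau (.dup i) γ m).1 = γ.take i ++ γ[i - 1] :: γ.drop i := by
      simp [eVLSM, List.getElem?_eq_getElem hlt]
    rw [htau]
    refine Or.inr ⟨by simp, ?_, fun d => headD_insert _ _ _ h1 h2, fun x hx => Or.inl ?_⟩
    · rw [length_insert]; omega
    · rcases mem_insert _ _ _ hx with rfl | hx
      · exact List.getElem_mem hlt
      · exact hx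
  | new i s0 =>
    obtain ⟨h1, h2, -, h0⟩ := h
    have htau : ((eVLSM V).tau (.new i s0) γ m).1 = γ.take i ++ s0 :: γ.drop i := rfl
    rw [htau]
    refine Or.inr ⟨by simp, ?_, fun d => headD_insert _ _ _ h1 h2, fun x hx => ?_⟩
    · rw [length_insert]; omega
    · rcases mem_insert _ _ _ hx with rfl | hx
      · refine Or.inr ⟨h0, ?_⟩
        rw [length_insert]; omega
      · exact Or.inl hx

theorem eVLSM_length_le {L S M : Type*} (V : VLSM L S M) (lab : ELabel L S) (γ : List S)
    (m : Option M) (h : (eVLSM V).beta lab γ m) :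
    γ.length ≤ ((eVLSM V).tau lab γ m).1.length := by
  rcases eVLSM_step_cases V lab γ m h with ⟨i, l, s, -, -, -, htau⟩ | ⟨-, hlen, -, -⟩
  · simp [htau]
  · exact hlen

/-- Extending a chain by a transition at its end. -/
theorem Chain.snoc {L S M : Type*} {s sf : S} {tr : List (VTrans L S M)}
    (h : Chain s tr sf) (t : VTrans L S M) (ht : t.src = sf) : Chain s (tr ++ [t]) t.dst := by
  induction tr generalizing s with
  | nil => exact ⟨ht.trans (Eq.symm h), rfl⟩
  | cons a tr ih => exact ⟨h.1, ih h.2⟩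

theorem VLSM.ConstrainedTraceTo.snoc {L S M : Type*} {V : VLSM L S M} {s : S}
    {tr : List (VTrans L S M)} (h : V.ConstrainedTraceTo tr s) {l : L} {m : Option M}
    (hb : V.beta l s m) :
    V.ConstrainedTraceTo (tr ++ [⟨l, s, m, (V.tau l s m).1, (V.tau l s m).2⟩])
      (V.tau l s m).1 := by
  obtain ⟨htr, s0, hs0, hc⟩ := h
  refine ⟨fun t ht => ?_, s0, hs0, hc.snoc _ rfl⟩
  rcases List.mem_append.1 ht with ht | ht
  · exact htr t ht
  · rw [List.mem_singleton.1 ht]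
    exact ⟨rfl, hb⟩

variable {n : ℕ} {Lf Sf : Fin n → Type} {M : Type}
  (V : ∀ i, VLSM (Lf i) (Sf i) M) (sender : M → Fin n)
  (sent : ∀ i, Sf i → M → Prop) (w : Fin n → ℝ) (t : ℝ)

/-- The components having more than one copy. -/
def multiCopy (γ : ∀ i, List (Sf i)) : Finset (Fin n) :=
  Finset.univ.filter fun k => 1 < (γ k).length

/-- Every selection of one copy per component, where the components in `E` may also select
an initial state, is a valid state of the message-equivocation model with equivocators in
`E`, and every copy has a history emitting only messages valid in that model. -/
structure CopiesRealizable (E : Finset (Fin n)) (γ : ∀ i, List (Sf i)) : Prop where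
  select : ∀ σ : ∀ i, Sf i, (∀ j, σ j ∈ γ j ∨ (j ∈ E ∧ σ j ∈ (V j).init)) →
    ∃ eqv ⊆ E, (annV V sender sent w t).ValidState (σ, eqv)
  history : ∀ j, ∀ s ∈ γ j, ∃ tr, (V j).ConstrainedTraceTo tr s ∧
    ∀ x ∈ tr, (annV V sender sent w t).ValidOMsg x.out
  ne_nil : ∀ j, γ j ≠ []

variable {V sender sent w t}

theorem multiCopy_step {t' : VTrans (Σ i, ELabel (Lf i) (Sf i)) (∀ i, List (Sf i)) M}
    (h : (Vslim V sender sent w t).IsConstrainedTrans t') :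
    multiCopy t'.src ⊆ multiCopy t'.dst := by
  obtain ⟨l, γ, m, γ', o⟩ := t'
  obtain ⟨htau, hb, -⟩ := h
  obtain rfl : ((Vslim V sender sent w t).tau l γ m).1 = γ' := congrArg Prod.fst htau
  intro k hk
  simp only [multiCopy, Finset.mem_filter, Finset.mem_univ, true_and] at hk ⊢
  by_cases hkl : k = l.1
  · subst hkl
    simp only [Vslim, comp, Function.update_self]
    exact hk.trans_le (eVLSM_length_le _ _ _ _ hb)
  · simpa [Vslim, comp, Function.update_of_ne hkl] using hk

theorem multiCopy_chain {γ γf : ∀ i, List (Sf i)}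
    {tr : List (VTrans (Σ i, ELabel (Lf i) (Sf i)) (∀ i, List (Sf i)) M)}
    (htr : ∀ x ∈ tr, (Vslim V sender sent w t).IsConstrainedTrans x) (hc : Chain γ tr γf) :
    multiCopy γ ⊆ multiCopy γf := by
  induction tr generalizing γ with
  | nil => rw [show γ = γf from hc]
  | cons a tr ih =>
    obtain ⟨rfl, hc⟩ := hc
    exact (multiCopy_step (htr a (by simp))).trans
      (ih (fun x hx => htr x (List.mem_cons_of_mem _ hx)) hc)

theorem multiCopy_weight_lt {γ γf : ∀ i, List (Sf i)}
    {tr : List (VTrans (Σ i, ELabel (Lf i) (Sf i)) (∀ i, List (Sf i)) M)}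
    (htr : ∀ x ∈ tr, (Vslim V sender sent w t).IsConstrainedTrans x) (hc : Chain γ tr γf)
    (hγ : ∑ k ∈ multiCopy γ, w k < t) : ∑ k ∈ multiCopy γf, w k < t := by
  induction tr generalizing γ with
  | nil => rwa [← show γ = γf from hc]
  | cons a tr ih =>
    obtain ⟨rfl, hc⟩ := hc
    refine ih (fun x hx => htr x (List.mem_cons_of_mem _ hx)) hc ?_
    obtain ⟨htau, -, -, hlt⟩ := htr a (by simp)
    rw [← show _ = a.dst from congrArg Prod.fst htau]
    exact hlt

/-- Receiving a message sent by some copy only makes its sender an equivocator if the sender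
belongs to `E`. -/
theorem updEqv_subset {E eqv : Finset (Fin n)} {γ : ∀ i, List (Sf i)} {σ : ∀ i, Sf i}
    {m : Option M} (hE : multiCopy γ ⊆ E) (heqv : eqv ⊆ E)
    (hσ : ∀ j, σ j ∈ γ j ∨ (j ∈ E ∧ σ j ∈ (V j).init))
    (hm : ∀ mm, m = some mm → ∃ s ∈ γ (sender mm), sent (sender mm) s mm) :
    updEqv sender sent σ m eqv ⊆ E := by
  cases m with
  | none => exact heqv
  | some mm =>
    simp only [updEqv]
    split_ifs with hs
    · exact heqv
    · refine Finset.insert_subset ?_ heqv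
      by_contra hn
      obtain ⟨s, hsγ, hss⟩ := hm mm rfl
      have hmem : σ (sender mm) ∈ γ (sender mm) := (hσ _).resolve_right fun h => hn h.1
      have hlen : ¬ 1 < (γ (sender mm)).length := fun h =>
        hn (hE (by simpa [multiCopy] using h))
      have heq : σ (sender mm) = s := by
        generalize γ (sender mm) = g at hsγ hmem hlen
        match g, hsγ, hmem, hlen with
        | [a], h1, h2, _ => rw [List.mem_singleton.1 h1, List.mem_singleton.1 h2]
        | _ :: _ :: _, _, _, h3 => simp at h3
      exact hs ⟨sender mm, by rwa [heq]⟩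

theorem CopiesRealizable.validOMsg (hsent : ∀ i, IsSentOracle (V i) (sent i))
    {E : Finset (Fin n)} {γ : ∀ i, List (Sf i)}
    (hγ : CopiesRealizable V sender sent w t E γ) {m : Option M}
    (hm : ∀ mm, m = some mm → ∃ s ∈ γ (sender mm), sent (sender mm) s mm) :
    (annV V sender sent w t).ValidOMsg m := by
  cases m with
  | none => exact .none
  | some mm =>
    obtain ⟨s, hs, hss⟩ := hm mm rfl
    obtain ⟨tr, htr, hout⟩ := hγ.history _ s hs
    obtain ⟨x, hx, hxm⟩ := (hsent _ s ⟨tr, htr⟩ mm).1 hss tr htr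
    exact hxm ▸ hout x hx

theorem CopiesRealizable.step (hsent : ∀ i, IsSentOracle (V i) (sent i))
    (hw : ∀ i, 0 < w i) {E : Finset (Fin n)} (hEt : ∑ j ∈ E, w j < t)
    {t' : VTrans (Σ i, ELabel (Lf i) (Sf i)) (∀ i, List (Sf i)) M}
    (h : (Vslim V sender sent w t).IsConstrainedTrans t')
    (hE : multiCopy t'.dst ⊆ E) (hγ : CopiesRealizable V sender sent w t E t'.src) :
    CopiesRealizable V sender sent w t E t'.dst := by
  have hE0 := (multiCopy_step h).trans hE
  obtain ⟨⟨j, l⟩, γ, m, γ', o⟩ := t'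
  obtain ⟨htau, hb, hm, -⟩ := h
  obtain rfl : ((Vslim V sender sent w t).tau ⟨j, l⟩ γ m).1 = γ' := congrArg Prod.fst htau
  have hvm := hγ.validOMsg hsent hm
  simp only [Vslim, comp] at hb hE hE0 hγ hm ⊢
  have hnil : ∀ k, Function.update γ j ((eVLSM (V j)).tau l (γ j) m).1 k ≠ [] := by
    intro k
    have hk := List.length_pos_iff.2 (hγ.ne_nil k)
    by_cases hkj : k = j
    · subst hkj
      have := eVLSM_length_le _ _ _ _ hb
      rw [Function.update_self]
      exact List.length_pos_iff.1 (by omega)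
    · rw [Function.update_of_ne hkj]
      exact hγ.ne_nil k
  rcases eVLSM_step_cases _ _ _ _ hb with ⟨i, a, s, -, hs, hba, hta⟩ | ⟨-, -, -, hmem⟩
  · rw [hta] at hE hnil ⊢
    have hsγ : s ∈ γ j := List.mem_of_getElem? hs
    have hbeta : ∀ σ : ∀ i, Sf i, (∀ k, σ k ∈ γ k ∨ (k ∈ E ∧ σ k ∈ (V k).init)) →
        σ j = s → ∃ eqv ⊆ E, (annV V sender sent w t).ValidState (σ, eqv) ∧
          (annV V sender sent w t).beta ⟨j, a⟩ (σ, eqv) m ∧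
          updEqv sender sent σ m eqv ⊆ E := by
      intro σ hσ hσj
      obtain ⟨eqv, heqv, hv⟩ := hγ.select σ hσ
      have hsub := updEqv_subset (V := V) hE0 heqv hσ hm
      refine ⟨eqv, heqv, hv, ⟨?_, ?_⟩, hsub⟩
      · simpa only [hσj] using hba
      · exact (Finset.sum_le_sum_of_subset_of_nonneg hsub
          fun k _ _ => (hw k).le).trans_lt hEt
    refine ⟨fun σ hσ => ?_, fun k x hx => ?_, hnil⟩
    · have hother : ∀ k, k ≠ j → (σ k ∈ γ k ∨ (k ∈ E ∧ σ k ∈ (V k).init)) := by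
        intro k hk
        simpa only [Function.update_of_ne hk] using hσ k
      have hσj : (σ j ∈ γ j ∨ (j ∈ E ∧ σ j ∈ (V j).init)) ∨ σ j = ((V j).tau a s m).1 := by
        rcases hσ j with hj | hj
        · rw [Function.update_self] at hj
          rcases List.mem_or_eq_of_mem_set hj with hj | hj
          · exact Or.inl (Or.inl hj)
          · exact Or.inr hj
        · exact Or.inl (Or.inr hj)
      rcases hσj with hσj | hσj
      · refine hγ.select σ fun k => ?_
        by_cases hk : k = j
        · subst hk; exact hσj
        · exact hother k hk
      · obtain ⟨eqv, -, hv, hbe, hsub⟩ := hbeta (Function.update σ j s) (fun k => by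
          by_cases hk : k = j
          · subst hk; exact Or.inl (by simpa using hsγ)
          · simpa only [Function.update_of_ne hk] using hother k hk) (by simp)
        refine ⟨_, hsub, ?_⟩
        have := VLSM.ValidState.step hv hvm hbe
        simpa [annV, ← hσj] using this
    · by_cases hk : k = j
      · subst hk
        rw [Function.update_self] at hx
        rcases List.mem_or_eq_of_mem_set hx with hx | rfl
        · exact hγ.history k x hx
        · obtain ⟨tr, htr, hout⟩ := hγ.history k s hsγ
          refine ⟨_, htr.snoc hba, fun y hy => ?_⟩
          rcases List.mem_append.1 hy with hy | hy
          · exact hout y hy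
          · rw [List.mem_singleton.1 hy]
            choose c hc using fun i => List.exists_mem_of_ne_nil _ (hγ.ne_nil i)
            obtain ⟨eqv, -, hv, hbe, -⟩ := hbeta (Function.update c k s) (fun i => by
              by_cases hi : i = k
              · subst hi; exact Or.inl (by simpa using hsγ)
              · exact Or.inl (by simpa only [Function.update_of_ne hi] using hc i)) (by simp)
            have := VLSM.ValidOMsg.step hv hvm hbe
            simpa [annV] using this
      · rw [Function.update_of_ne hk] at hx
        exact hγ.history k x hx
  · refine ⟨fun σ hσ => hγ.select σ fun k => ?_, fun k x hx => ?_, hnil⟩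
    · rcases hσ k with hk | hk
      · by_cases hkj : k = j
        · subst hkj
          rw [Function.update_self] at hk
          refine (hmem _ hk).imp id fun hi => ⟨hE ?_, hi.1⟩
          simpa [multiCopy] using hi.2
        · rw [Function.update_of_ne hkj] at hk
          exact Or.inl hk
      · exact Or.inr hk
    · by_cases hkj : k = j
      · subst hkj
        rw [Function.update_self] at hx
        rcases hmem _ hx with hx | hx
        · exact hγ.history k x hx
        · exact ⟨[], ⟨by simp, x, hx.1, rfl⟩, by simp⟩
      · rw [Function.update_of_ne hkj] at hx
        exact hγ.history k x hx

theorem reductLim_mem {γ : ∀ i, List (Sf i)} (hγ : ∀ j, γ j ≠ []) (j : Fin n) :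
    reductLim V γ j ∈ γ j := by
  have := hγ j
  unfold reductLim
  cases hj : γ j with
  | nil => exact absurd hj this
  | cons a g => simp

/-- A constrained transition of the state-equivocation model either has no reduct and leaves
the state reduct unchanged, or reduces to a transition of the free composition. -/
theorem transReductLim_cases {t' : VTrans (Σ i, ELabel (Lf i) (Sf i)) (∀ i, List (Sf i)) M}
    (h : (Vslim V sender sent w t).IsConstrainedTrans t') :
    (transReductLim V t' = none ∧ reductLim V t'.dst = reductLim V t'.src) ∨
    ∃ r, transReductLim V t' = some r ∧ r.src = reductLim V t'.src ∧
      r.dst = reductLim V t'.dst ∧ r.msg = t'.msg ∧ (freeComp V).IsConstrainedTrans r := by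
  obtain ⟨⟨j, l⟩, γ, m, γ', o⟩ := t'
  obtain ⟨htau, hb, -⟩ := h
  obtain rfl : ((Vslim V sender sent w t).tau ⟨j, l⟩ γ m).1 = γ' := congrArg Prod.fst htau
  obtain rfl : ((Vslim V sender sent w t).tau ⟨j, l⟩ γ m).2 = o := congrArg Prod.snd htau
  have hred : ∀ g : List (Sf j), reductLim V (Function.update γ j g) =
      Function.update (reductLim V γ) j (g.headD (V j).init_ne.choose) := by
    intro g
    funext k
    by_cases hk : k = j
    · subst hk; simp [reductLim]
    · simp [reductLim, Function.update_of_ne hk]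
  simp only [Vslim, comp] at hb ⊢
  rw [hred]
  rcases eVLSM_step_cases _ _ _ _ hb with ⟨i, a, s, rfl, hs, hba, hta⟩ | ⟨hl, -, hhead, -⟩
  · rw [hta]
    cases i with
    | zero =>
      obtain ⟨g, hg⟩ : ∃ g, γ j = s :: g := by
        cases hj : γ j with
        | nil => simp [hj] at hs
        | cons b g => exact ⟨g, by simpa [hj] using hs⟩
      have hrj : reductLim V γ j = s := by simp [reductLim, hg]
      refine Or.inr ⟨_, rfl, rfl, hred _, rfl, ?_, ?_, trivial⟩
      · simp [VLSM.IsTrans, freeComp, comp, hred, hrj, hg]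
      · simpa only [hrj] using hba
    | succ i =>
      refine Or.inl ⟨rfl, ?_⟩
      have : ((γ j).set (i + 1) ((V j).tau a s m).1).headD (V j).init_ne.choose =
          reductLim V γ j := by
        unfold reductLim
        cases γ j <;> simp
      simp only [this, Function.update_eq_self]
  · refine Or.inl ⟨?_, ?_⟩
    · cases l with
      | act i a => exact absurd rfl (hl i a)
      | dup i => rfl
      | new i s0 => rfl
    · rw [hhead]
      exact Function.update_eq_self j (reductLim V γ)

theorem annotate_traceReductLim_valid (hsent : ∀ i, IsSentOracle (V i) (sent i))
    (hw : ∀ i, 0 < w i) {E : Finset (Fin n)} (hEt : ∑ j ∈ E, w j < t)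
    {γ γf : ∀ i, List (Sf i)} {eqv : Finset (Fin n)}
    {tr : List (VTrans (Σ i, ELabel (Lf i) (Sf i)) (∀ i, List (Sf i)) M)}
    (htr : ∀ x ∈ tr, (Vslim V sender sent w t).IsConstrainedTrans x) (hc : Chain γ tr γf)
    (hE : multiCopy γf ⊆ E) (hγ : CopiesRealizable V sender sent w t E γ)
    (heqv : eqv ⊆ E) (hv : (annV V sender sent w t).ValidState (reductLim V γ, eqv)) :
    (∀ x ∈ annotate sender sent eqv (traceReductLim V tr),
      (annV V sender sent w t).IsValidTrans x) ∧
    ∃ sf, Chain (reductLim V γ, eqv) (annotate sender sent eqv (traceReductLim V tr)) sf := by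
  induction tr generalizing γ eqv with
  | nil => exact ⟨by simp [traceReductLim, annotate], _, rfl⟩
  | cons a tr ih =>
    obtain ⟨rfl, hc⟩ := hc
    have ha := htr a (by simp)
    have htr' : ∀ x ∈ tr, (Vslim V sender sent w t).IsConstrainedTrans x :=
      fun x hx => htr x (List.mem_cons_of_mem _ hx)
    have hEd := (multiCopy_chain htr' hc).trans hE
    have hstep := hγ.step hsent hw hEt ha hEd
    rcases transReductLim_cases ha with ⟨hnone, hred⟩ | ⟨r, hr, hsrc, hdst, hmsg, hrt, hrb, -⟩
    · have : traceReductLim V (a :: tr) = traceReductLim V tr := by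
        simp [traceReductLim, hnone]
      rw [this, ← hred]
      exact ih htr' hc hstep heqv (by rwa [hred])
    · have hcons : traceReductLim V (a :: tr) = r :: traceReductLim V tr := by
        simp [traceReductLim, hr]
      have hm := ha.2.2.1
      have hsub : updEqv sender sent r.src r.msg eqv ⊆ E := by
        rw [hsrc, hmsg]
        exact updEqv_subset (V := V) ((multiCopy_step ha).trans hEd) heqv
          (fun j => Or.inl (reductLim_mem hγ.ne_nil j)) hm
      have hvt : (annV V sender sent w t).IsValidTrans
          ⟨r.lbl, (r.src, eqv), r.msg, (r.dst, updEqv sender sent r.src r.msg eqv), r.out⟩ := by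
        refine ⟨⟨?_, hrb, ?_⟩, ?_, ?_⟩
        · obtain ⟨h1, h2⟩ := Prod.ext_iff.1 hrt
          exact Prod.ext (Prod.ext h1 rfl) h2
        · exact (Finset.sum_le_sum_of_subset_of_nonneg hsub
            fun k _ _ => (hw k).le).trans_lt hEt
        · simpa only [hsrc] using hv
        · simpa only [hmsg] using hγ.validOMsg hsent hm
      have hvd : (annV V sender sent w t).ValidState
          (reductLim V a.dst, updEqv sender sent r.src r.msg eqv) := by
        have := VLSM.ValidState.step hvt.2.1 hvt.2.2 hvt.1.2
        rwa [show _ = (_, _) from hvt.1.1, hdst] at this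
      obtain ⟨hall, sf, hsf⟩ := ih htr' hc hstep hsub hvd
      rw [hcons]
      refine ⟨fun x hx => ?_, sf, ?_, ?_⟩
      · rcases List.mem_cons.1 hx with rfl | hx
        · exact hvt
        · exact hall x hx
      · simp only [hsrc]
      · simpa only [hdst] using hsf

theorem CopiesRealizable.of_init {E : Finset (Fin n)} {γ : ∀ i, List (Sf i)}
    (hγ : γ ∈ (Vslim V sender sent w t).init) : CopiesRealizable V sender sent w t E γ := by
  have hmem : ∀ j, ∀ s ∈ γ j, s ∈ (V j).init := by
    intro j s hs
    obtain ⟨s0, hs0, hj⟩ := hγ j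
    rw [hj, List.mem_singleton] at hs
    exact hs ▸ hs0
  refine ⟨fun σ hσ => ⟨∅, by simp, .init ⟨fun j => ?_, rfl⟩⟩,
    fun j s hs => ⟨[], ⟨by simp, s, hmem j s hs, rfl⟩, by simp⟩, fun j => ?_⟩
  · exact (hσ j).elim (hmem j _) And.right
  · obtain ⟨s0, -, hj⟩ := hγ j
    simp [hj]

end StateToMessageEquivocation

/-- The trace reduct of a valid trace of the t-limited state-equivocation model,
annotated with the accumulated sets of equivocators starting from `∅`, is a valid
trace of the t-limited message-equivocation model. -/
theorem limited_state_to_message_equivocation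
    {n : ℕ} {Lf Sf : Fin n → Type} {M : Type}
    (V : ∀ i, VLSM (Lf i) (Sf i) M) (sender : M → Fin n) (dep : M → M → Prop)
    (sent recv : ∀ i, Sf i → M → Prop)
    (hsent : ∀ i, IsSentOracle (V i) (sent i))
    (hrecv : ∀ i, IsReceivedOracle (V i) (recv i))
    (hfull : ∀ i, FullNodeAssumption (V i) dep (sent i) (recv i))
    (w : Fin n → ℝ) (hw : ∀ i, 0 < w i) (t : ℝ) (ht : 0 < t)
    (tr : List (VTrans (Σ i, ELabel (Lf i) (Sf i)) (∀ i, List (Sf i)) M))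
    (h : (Vslim V sender sent w t).IsValidTrace tr) :
    (annV V sender sent w t).IsValidTrace
      (annotate sender sent ∅ (traceReductLim V tr)) := by
  obtain ⟨γf, htr, γ, hγ, hc⟩ := h
  have htr' : ∀ x ∈ tr, (Vslim V sender sent w t).IsConstrainedTrans x :=
    fun x hx => (htr x hx).1
  have hmulti : multiCopy γ = ∅ := by
    refine Finset.filter_eq_empty_iff.2 fun k _ => ?_
    obtain ⟨s0, -, hk⟩ := hγ k
    simp [hk]
  have hEt : ∑ k ∈ multiCopy γf, w k < t :=
    multiCopy_weight_lt htr' hc (by simpa [hmulti] using ht)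
  have hcop : CopiesRealizable V sender sent w t (multiCopy γf) γ := .of_init hγ
  have hinit : (reductLim V γ, (∅ : Finset (Fin n))) ∈ (annV V sender sent w t).init := by
    refine ⟨fun j => ?_, rfl⟩
    obtain ⟨s0, hs0, hj⟩ := hγ j
    simpa [reductLim, hj] using hs0
  obtain ⟨hall, sf, hsf⟩ := annotate_traceReductLim_valid hsent hw hEt htr' hc
    subset_rfl hcop (Finset.empty_subset _) (.init hinit)
  exact ⟨sf, hall, _, hinit, hsf⟩
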